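/- Let f ∈ C(x), let L = D + f, and let c ∈ C be a pole of f. Then for every integer i ≥ Sind(L) + 1, there exists a polynomial p_i ∈ C[x] of degree i such that the equation -r' + f·r = p_i/(x - c) has a solution r ∈ C(x). -/

import Mathlib

open Polynomial

/-- The derivative of a rational function, computed via the quotient rule on the
reduced numerator/denominator representation. -/
noncomputable def rderiv {C : Type} [Field C] (f : RatFunc C) : RatFunc C :=
  algebraMap (Polynomial C) (RatFunc C)
      (derivative f.num * f.denom - f.num * derivative f.denom) /
    algebraMap (Polynomial C) (RatFunc C) (f.denom ^ 2)

/-- The adjoint of the first-order operator `D + f` applied to `r`: `L*(r) = -r' + f*r`. -/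
noncomputable def adjD {C : Type} [Field C] (f r : RatFunc C) : RatFunc C :=
  -rderiv r + f * r

/-- The stability index of an operator with adjoint action `adj` on `C(x)`: the minimal
`m` such that for every `i ≥ m` there is a polynomial of degree `i` in the image of the
adjoint on `C(x)`. -/
noncomputable def sindOf {C : Type} [Field C] (adj : RatFunc C → RatFunc C) : ℕ :=
  sInf {m : ℕ | ∀ i : ℕ, m ≤ i → ∃ p : Polynomial C, p.degree = (i : ℕ) ∧
    ∃ r : RatFunc C, adj r = algebraMap (Polynomial C) (RatFunc C) p}

theorem rderiv_algebraMap {C : Type} [Field C] (p : Polynomial C) :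
    rderiv (algebraMap (Polynomial C) (RatFunc C) p) =
      algebraMap (Polynomial C) (RatFunc C) (derivative p) := by
  simp [rderiv]

theorem adjD_algebraMap_denom_mul {C : Type} [Field C] (f : RatFunc C) (q : Polynomial C) :
    adjD f (algebraMap (Polynomial C) (RatFunc C) (f.denom * q)) =
      algebraMap (Polynomial C) (RatFunc C)
        ((f.num - derivative f.denom) * q - f.denom * derivative q) := by
  have hd : algebraMap (Polynomial C) (RatFunc C) f.denom ≠ 0 :=
    RatFunc.algebraMap_ne_zero f.denom_ne_zero
  have hf : f * algebraMap (Polynomial C) (RatFunc C) f.denom =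
      algebraMap (Polynomial C) (RatFunc C) f.num :=
    (eq_div_iff hd).mp f.num_div_denom.symm
  rw [adjD, rderiv_algebraMap, derivative_mul]
  simp only [map_add, map_sub, map_mul, ← hf]
  ring

/-- A first-order operator `q ↦ A * q - B * q'` with polynomial coefficients, `B` not constant,
attains every sufficiently large degree on polynomials. -/
theorem exists_forall_degree_mul_sub_mul_derivative {C : Type} [Field C] [CharZero C]
    (A B : Polynomial C) (hB : B.natDegree ≠ 0) :
    ∃ m : ℕ, ∀ i : ℕ, m ≤ i → ∃ q : Polynomial C,
      (A * q - B * derivative q).degree = (i : ℕ) := by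
  obtain ⟨k, hA, hBk, hne⟩ : ∃ k, A.natDegree ≤ k ∧ B.natDegree ≤ k + 1 ∧
      (A.coeff k ≠ 0 ∨ B.coeff (k + 1) ≠ 0) := by
    have hB0 : B.leadingCoeff ≠ 0 := by
      rw [leadingCoeff_ne_zero]; rintro rfl; simp at hB
    by_cases h : B.natDegree ≤ A.natDegree
    · refine ⟨A.natDegree, le_rfl, by omega, Or.inl ?_⟩
      rw [coeff_natDegree, leadingCoeff_ne_zero]
      rintro rfl
      simp at h
      omega
    · refine ⟨B.natDegree - 1, by omega, by omega, Or.inr ?_⟩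
      rwa [Nat.sub_add_cancel (by omega)]
  obtain ⟨N, hN⟩ : ∃ N : ℕ, ∀ n : ℕ, N ≤ n → A.coeff k - B.coeff (k + 1) * (n + 1 : ℕ) ≠ 0 := by
    by_cases hb : B.coeff (k + 1) = 0
    · exact ⟨0, fun n _ => by simpa [hb] using hne⟩
    · by_cases h : ∃ n : ℕ, A.coeff k - B.coeff (k + 1) * (n + 1 : ℕ) = 0
      · obtain ⟨n₀, h₀⟩ := h
        refine ⟨n₀ + 1, fun n hn h => ?_⟩
        have := mul_left_cancel₀ hb ((sub_eq_zero.mp h).symm.trans (sub_eq_zero.mp h₀))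
        have := Nat.cast_injective this
        omega
      · push Not at h
        exact ⟨0, fun n _ => h n⟩
  refine ⟨N + k + 1, fun i hi => ?_⟩
  obtain ⟨n, rfl⟩ : ∃ n, i = k + 1 + n := ⟨i - (k + 1), by omega⟩
  have hq : derivative (X ^ (n + 1) : Polynomial C) = Polynomial.C ((n + 1 : ℕ) : C) * X ^ n := by
    simp
  refine ⟨X ^ (n + 1), le_antisymm ?_ (le_degree_of_ne_zero ?_)⟩
  · rw [hq]
    refine degree_le_of_natDegree_le ((natDegree_sub_le _ _).trans (max_le ?_ ?_))
    · refine natDegree_mul_le.trans ?_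
      rw [natDegree_X_pow]
      omega
    · refine natDegree_mul_le.trans ?_
      have := natDegree_C_mul_X_pow_le ((n + 1 : ℕ) : C) n
      omega
  · have h₁ : (A * X ^ (n + 1)).coeff (k + 1 + n) = A.coeff k := by
      rw [show k + 1 + n = k + (n + 1) by ring, coeff_mul_X_pow]
    have h₂ : (B * (Polynomial.C ((n + 1 : ℕ) : C) * X ^ n)).coeff (k + 1 + n) =
        B.coeff (k + 1) * (n + 1 : ℕ) := by
      rw [← mul_assoc, coeff_mul_X_pow, coeff_mul_C]
    rw [hq, coeff_sub, h₁, h₂]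
    exact hN n (by omega)

/-- When `f` has a pole, the infimum defining the stability index of `D + f` is attained. -/
theorem exists_degree_eq_of_sindOf_le {C : Type} [Field C] [CharZero C]
    (f : RatFunc C) (hf : f.denom.natDegree ≠ 0) (i : ℕ) (hi : sindOf (adjD f) ≤ i) :
    ∃ p : Polynomial C, p.degree = (i : ℕ) ∧
      ∃ r : RatFunc C, adjD f r = algebraMap (Polynomial C) (RatFunc C) p := by
  obtain ⟨m, hm⟩ := exists_forall_degree_mul_sub_mul_derivative
    (f.num - derivative f.denom) f.denom hf
  refine Nat.sInf_mem (s := {m : ℕ | ∀ i : ℕ, m ≤ i → ∃ p : Polynomial C, p.degree = (i : ℕ) ∧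
    ∃ r : RatFunc C, adjD f r = algebraMap (Polynomial C) (RatFunc C) p})
    ⟨m, fun j hj => ?_⟩ i hi
  obtain ⟨q, hq⟩ := hm j hj
  exact ⟨_, hq, _, adjD_algebraMap_denom_mul f q⟩

/-- Lemma 4.8(1). Let `c` be a pole of `f` and `L = D + f`. For every
`i ≥ Sind(L) + 1` there is a polynomial `p` of degree `i` such that
`-r' + f*r = p/(x-c)` has a rational solution. -/
theorem solution_simple_pole_rhs {C : Type} [Field C] [IsAlgClosed C] [CharZero C]
    (f : RatFunc C) (c : C) (hc : f.denom.eval c = 0) :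
    ∀ i : ℕ, sindOf (adjD f) + 1 ≤ i →
      ∃ p : Polynomial C, p.degree = (i : ℕ) ∧
        ∃ r : RatFunc C, adjD f r =
          algebraMap (Polynomial C) (RatFunc C) p / (RatFunc.X - RatFunc.C c) := by
  intro i hi
  obtain ⟨j, rfl⟩ : ∃ j, i = j + 1 := ⟨i - 1, by omega⟩
  have hf : f.denom.natDegree ≠ 0 :=
    (natDegree_pos_of_eval₂_root f.denom_ne_zero (RingHom.id C) hc (by simp)).ne'
  obtain ⟨p, hp, r, hr⟩ := exists_degree_eq_of_sindOf_le f hf j (by omega)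
  refine ⟨p * (X - Polynomial.C c), by rw [degree_mul, hp, degree_X_sub_C]; rfl, r, ?_⟩
  have hX : algebraMap (Polynomial C) (RatFunc C) (X - Polynomial.C c) =
      RatFunc.X - RatFunc.C c := by simp
  rw [hr, map_mul, ← hX, mul_div_cancel_right₀ _ (RatFunc.algebraMap_ne_zero (X_sub_C_ne_zero c))]
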